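/- arXiv:0712.1597 — 2 statements merged into one kernel-verified Lean document; each statement's English description precedes it below -/
import Mathlib

section
/- Let a, b ∈ ℤ with 0 ≤ b − a ≤ 3. Then there are only finitely many isomorphism classes of indecomposable e(2)-modules V all of whose weights lie in the interval [a,b]; that is, there exists a finite list V¹, …, Vⁿ of e(2)-modules such that every indecomposable e(2)-module V with V_k = 0 for k < a or k > b is isomorphic to some Vʲ. -/
/-- An `e(2)`-module: a finite-dimensional complex vector space `V` with endomorphisms
`Pp = P₊`, `Pm = P₋`, `L` satisfying `P₊∘P₋ = P₋∘P₊`, `L∘P₊ − P₊∘L = P₊`,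
`L∘P₋ − P₋∘L = −P₋`, such that `V` is the internal direct sum of the eigenspaces
`V_k = ker (L − k·id)`, `k ∈ ℤ`. -/
structure E2Mod : Type 1 where
  V : Type
  [acg : AddCommGroup V]
  [mod : Module ℂ V]
  [fd : FiniteDimensional ℂ V]
  Pp : V →ₗ[ℂ] V
  Pm : V →ₗ[ℂ] V
  L : V →ₗ[ℂ] V
  comm : Pp.comp Pm = Pm.comp Pp
  relp : L.comp Pp - Pp.comp L = Pp
  relm : L.comp Pm - Pm.comp L = -Pm
  internal : DirectSum.IsInternal fun k : ℤ =>
    LinearMap.ker (L - (k : ℂ) • (LinearMap.id : V →ₗ[ℂ] V))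

attribute [instance] E2Mod.acg E2Mod.mod E2Mod.fd

namespace E2Mod

/-- The `k`-weight space `V_k = ker (L - k·id)`. -/
def wt (M : E2Mod) (k : ℤ) : Submodule ℂ M.V :=
  LinearMap.ker (M.L - (k : ℂ) • (LinearMap.id : M.V →ₗ[ℂ] M.V))

/-- A subspace is a submodule if it is invariant under `P₊`, `P₋` and `L`. -/
def IsSubmod (M : E2Mod) (S : Submodule ℂ M.V) : Prop :=
  (∀ v ∈ S, M.Pp v ∈ S) ∧ (∀ v ∈ S, M.Pm v ∈ S) ∧ (∀ v ∈ S, M.L v ∈ S)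

/-- An `e(2)`-module is indecomposable if it is nonzero and admits no nontrivial
decomposition as an internal direct sum of two submodules. -/
def Indecomposable (M : E2Mod) : Prop :=
  (∃ v : M.V, v ≠ 0) ∧
    ∀ W₁ W₂ : Submodule ℂ M.V, M.IsSubmod W₁ → M.IsSubmod W₂ →
      W₁ ⊓ W₂ = ⊥ → W₁ ⊔ W₂ = ⊤ → W₁ = ⊥ ∨ W₂ = ⊥

/-- Isomorphism of `e(2)`-modules: a bijective linear map commuting with `P₊, P₋, L`. -/
def Iso (M N : E2Mod) : Prop :=
  ∃ e : M.V ≃ₗ[ℂ] N.V,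
    (∀ v, e (M.Pp v) = N.Pp (e v)) ∧ (∀ v, e (M.Pm v) = N.Pm (e v)) ∧
      (∀ v, e (M.L v) = N.L (e v))

end E2Mod

/-- `v` is a combination of the family `e` with coefficients in `{-1, 0, 1}`. -/
def SmallComb {V : Type} [AddCommGroup V] [Module ℂ V] {ι : Type} [Fintype ι] (e : ι → V)
    (v : V) : Prop :=
  ∃ c : ι → SignType, v = ∑ i, (((c i : SignType) : ℤ) : ℂ) • e i

/-- At most two vectors together with as many functionals, with nondegenerate Gram matrix. -/
structure Frame (V : Type) [AddCommGroup V] [Module ℂ V] where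
  n : ℕ
  le : n ≤ 2
  e : Fin n → V
  φ : Fin n → Module.Dual ℂ V
  gram : ∀ c : Fin n → ℂ, (∀ i, ∑ j, c j * φ i (e j) = 0) → c = 0

/-- The map `α` is compatible with the frames `F` and `G`. -/
def Frame.Maps {V W : Type} [AddCommGroup V] [Module ℂ V] [AddCommGroup W] [Module ℂ W]
    (F : Frame V) (G : Frame W) (α : V →ₗ[ℂ] W) : Prop :=
  (∀ s, SmallComb G.e (α (F.e s))) ∧ ∀ t, G.φ t ∘ₗ α ∈ Submodule.span ℂ (Set.range F.φ)

section Frames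

variable {V W : Type} [AddCommGroup V] [Module ℂ V] [AddCommGroup W] [Module ℂ W]

theorem SmallComb.zero {ι : Type} [Fintype ι] (e : ι → V) : SmallComb e 0 :=
  ⟨fun _ => 0, by simp⟩

theorem SmallComb.mem {ι : Type} [Fintype ι] (e : ι → V) (i : ι) : SmallComb e (e i) := by
  classical
  refine ⟨Pi.single i 1, ?_⟩
  rw [Finset.sum_eq_single i]
  · simp
  · intro j _ hj
    simp [hj]
  · simp

theorem SmallComb.neg {ι : Type} [Fintype ι] {e : ι → V} {v : V} (h : SmallComb e v) :
    SmallComb e (-v) := by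
  obtain ⟨c, rfl⟩ := h
  exact ⟨fun i => -c i, by simp⟩

theorem SmallComb.map {ι : Type} [Fintype ι] {e : ι → V} {v : V} (h : SmallComb e v)
    (g : V →ₗ[ℂ] W) : SmallComb (g ∘ e) (g v) := by
  obtain ⟨c, rfl⟩ := h
  exact ⟨c, by simp⟩

theorem SmallComb.of_comp {ι κ : Type} [Fintype ι] [Fintype κ] {f : ι → κ}
    (hf : Function.Injective f) {e : κ → V} {v : V} (h : SmallComb (e ∘ f) v) :
    SmallComb e v := by
  obtain ⟨c, rfl⟩ := h
  refine ⟨Function.extend f c 0, Fintype.sum_of_injective f hf _ _ (fun i hi => ?_) fun i => ?_⟩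
  · rw [Function.extend_apply' _ _ _ (by simpa using hi)]
    simp
  · rw [hf.extend_apply]
    rfl

theorem SmallComb.mem_span {ι : Type} [Fintype ι] {e : ι → V} {v : V} (h : SmallComb e v) :
    v ∈ Submodule.span ℂ (Set.range e) := by
  obtain ⟨c, rfl⟩ := h
  exact sum_mem fun i _ => Submodule.smul_mem _ _ (Submodule.subset_span ⟨i, rfl⟩)

theorem smallComb_pair_add (v w : V) : SmallComb ![v, w] (v + w) :=
  ⟨fun _ => 1, by simp⟩

/-- The empty frame. -/
def Frame.nil (V : Type) [AddCommGroup V] [Module ℂ V] : Frame V where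
  n := 0
  le := by norm_num
  e := ![]
  φ := ![]
  gram := fun c _ => Subsingleton.elim _ _

/-- A frame consisting of one vector. -/
def Frame.one (v : V) (φ : Module.Dual ℂ V) (h : φ v = 1) : Frame V where
  n := 1
  le := by norm_num
  e := ![v]
  φ := ![φ]
  gram := fun c hc => by
    ext i
    have := hc 0
    fin_cases i
    simpa [h] using this

/-- A frame consisting of two vectors, with triangular Gram matrix. -/
def Frame.two (v w : V) (φ ψ : Module.Dual ℂ V) (h₁ : φ v = 1) (h₂ : φ w = 0) (h₃ : ψ w = 1) :
    Frame V where
  n := 2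
  le := le_rfl
  e := ![v, w]
  φ := ![φ, ψ]
  gram := fun c hc => by
    have h0 := hc 0
    have h1 := hc 1
    simp [h₁, h₂, Fin.sum_univ_two] at h0
    simp [h₃, h0, Fin.sum_univ_two] at h1
    ext i
    fin_cases i
    · exact h0
    · exact h1

theorem Frame.maps_nil_nil (α : V →ₗ[ℂ] W) : (Frame.nil V).Maps (Frame.nil W) α :=
  ⟨fun s => s.elim0, fun t => t.elim0⟩

theorem Frame.maps_nil (G : Frame W) (α : V →ₗ[ℂ] W) (h : ∀ t x, G.φ t (α x) = 0) :
    (Frame.nil V).Maps G α := by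
  refine ⟨fun s => s.elim0, fun t => ?_⟩
  convert Submodule.zero_mem _
  ext x
  exact h t x

theorem Frame.maps_to_nil (F : Frame V) (α : V →ₗ[ℂ] W) (h : ∀ s, α (F.e s) = 0) :
    F.Maps (Frame.nil W) α := by
  refine ⟨fun s => ?_, fun t => t.elim0⟩
  rw [h]
  exact SmallComb.zero _

theorem exists_dual_comp_eq (c : V →ₗ[ℂ] W) (φ : Module.Dual ℂ V)
    (h : ∀ x, c x = 0 → φ x = 0) : ∃ χ : Module.Dual ℂ W, χ ∘ₗ c = φ := by
  have : φ ∈ LinearMap.range c.dualMap := by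
    rw [LinearMap.range_dualMap_eq_dualAnnihilator_ker, Submodule.mem_dualAnnihilator]
    exact h
  exact this

theorem exists_dual_eq_one {p : Submodule ℂ V} {v : V} (hv : v ∉ p) :
    ∃ f : Module.Dual ℂ V, f v = 1 ∧ ∀ x ∈ p, f x = 0 := by
  obtain ⟨f, hf, hp⟩ := Submodule.exists_le_ker_of_notMem hv
  refine ⟨(f v)⁻¹ • f, by simp [hf], fun x hx => ?_⟩
  have : f x = 0 := hp hx
  simp [this]

/-- Two distinct subspaces `K`, `I` together with a flag `A` admit a basic direct summand on
which `K` and `I` differ. -/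
theorem exists_summand_of_ne {K I : Submodule ℂ V} (hKI : K ≠ I) {A : ℕ → Submodule ℂ V}
    (hA : Monotone A) (h0 : A 0 = ⊥) (h3 : A 3 = ⊤) :
    (∃ p, ∃ k ∈ K, k ∈ A (p + 1) ∧ k ∉ I ⊔ A p) ∨ (∃ p, ∃ i ∈ I, i ∈ A (p + 1) ∧ i ∉ K ⊔ A p) ∨
    ∃ p q, p < q ∧ q < 3 ∧ ∃ k ∈ K, ∃ i ∈ I, k ∈ A (q + 1) ∧ i ∈ A (q + 1) ∧ k + i ∈ A (p + 1) ∧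
      ∃ f g : Module.Dual ℂ V, (∀ x ∈ K, f x = 0) ∧ (∀ x ∈ I, g x = 0) ∧ (∀ x ∈ A p, f x = 0) ∧
        (∀ x ∈ A p, g x = 0) ∧ (∀ x ∈ A q, f x = g x) ∧ g k = 1 ∧ f i = 1 := by
  classical
  by_contra! hcon
  obtain ⟨hK, hI, hcon⟩ := hcon
  have hex : ∃ q, K ⊓ A q ≠ I ⊓ A q := ⟨3, by simpa [h3] using hKI⟩
  obtain ⟨q, hq⟩ : ∃ q, Nat.find hex = q + 1 := by
    refine Nat.exists_eq_succ_of_ne_zero fun h => ?_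
    have := Nat.find_spec hex
    rw [h] at this
    simp [h0] at this
  have hq3 : q < 3 := by
    have := Nat.find_min' hex (m := 3) (by simpa [h3] using hKI)
    omega
  have hne := Nat.find_spec hex
  rw [hq] at hne
  have heq : K ⊓ A q = I ⊓ A q := not_not.1 (Nat.find_min hex (m := q) (by omega))
  have hKIq : ∀ x ∈ A q, (x ∈ K ↔ x ∈ I) := fun x hx => by
    have := SetLike.ext_iff.1 heq x
    simpa [hx] using this
  have hk : ∃ k ∈ K, k ∈ A (q + 1) ∧ k ∉ I := by
    by_contra! hall
    refine hne (le_antisymm (fun x hx => ⟨hall x hx.1 hx.2, hx.2⟩) fun i hi => ?_)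
    obtain ⟨k, hk, a, ha, rfl⟩ := Submodule.mem_sup.1 (hI q i hi.1 hi.2)
    have haq := hA (Nat.le_succ q) ha
    have hkA : k ∈ A (q + 1) := by simpa using sub_mem hi.2 haq
    have haI : a ∈ I := by simpa using sub_mem hi.1 (hall k hk hkA)
    exact ⟨add_mem hk ((hKIq a ha).2 haI), hi.2⟩
  have hp : ∃ p, ∃ k ∈ K, k ∈ A (q + 1) ∧ k ∉ I ∧ ∃ i ∈ I, k + i ∈ A p := by
    obtain ⟨k, hk, hkA, hkI⟩ := hk
    obtain ⟨i, hi, a, ha, hia⟩ := Submodule.mem_sup.1 (hK q k hk hkA)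
    refine ⟨q, k, hk, hkA, hkI, -i, neg_mem hi, ?_⟩
    rw [← hia]
    simpa using ha
  have hpq : Nat.find hp ≤ q := by
    obtain ⟨k, hk, hkA, hkI⟩ := hk
    obtain ⟨i, hi, a, ha, hia⟩ := Submodule.mem_sup.1 (hK q k hk hkA)
    refine Nat.find_min' hp ⟨k, hk, hkA, hkI, -i, neg_mem hi, ?_⟩
    rw [← hia]
    simpa using ha
  obtain ⟨p, hpp⟩ : ∃ p, Nat.find hp = p + 1 := by
    refine Nat.exists_eq_succ_of_ne_zero fun h => ?_
    obtain ⟨k, -, -, hkI, i, hi, hki⟩ := Nat.find_spec hp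
    rw [h, h0, Submodule.mem_bot] at hki
    exact hkI (by rw [eq_neg_of_add_eq_zero_left hki]; exact neg_mem hi)
  have hmin := Nat.find_min hp (m := p) (by omega)
  obtain ⟨k, hk, hkA, hkI, i, hi, hki⟩ := Nat.find_spec hp
  rw [hpp] at hki
  have hiA : i ∈ A (q + 1) := by
    have := hA (show p + 1 ≤ q + 1 by omega) hki
    simpa using sub_mem this hkA
  let D : V →ₗ[ℂ] V × V := LinearMap.prod LinearMap.id (-LinearMap.id)
  have hnot : ((0 : V), k) ∉ (K ⊔ A p).prod (I ⊔ A p) ⊔ (A q).map D := by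
    intro hmem
    obtain ⟨⟨y, y'⟩, ⟨hy, hy'⟩, z, ⟨x, hx, rfl⟩, hyz⟩ := Submodule.mem_sup.1 hmem
    obtain ⟨κ, hκ, α, hα, rfl⟩ := Submodule.mem_sup.1 hy
    obtain ⟨ι, hι, α', hα', rfl⟩ := Submodule.mem_sup.1 hy'
    simp only [D, LinearMap.prod_apply, Function.prod_apply, LinearMap.id_apply,
      LinearMap.neg_apply, Prod.mk_add_mk, Prod.mk.injEq] at hyz
    obtain ⟨e1, e2⟩ := hyz
    have hαq := hA (show p ≤ q by omega) hα
    have hκe : κ = -(x + α) := by rw [eq_neg_iff_add_eq_zero, ← e1]; abel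
    have hκq : κ ∈ A q := by rw [hκe]; exact neg_mem (add_mem hx hαq)
    have hκI := (hKIq κ hκq).1 hκ
    refine hmin ⟨k - κ, sub_mem hk hκ, sub_mem hkA (hA (Nat.le_succ q) hκq), fun h => hkI ?_,
      -ι, neg_mem hι, ?_⟩
    · simpa using add_mem h hκI
    · have : k - κ + -ι = α' + α := by
        rw [← e2, show x = -(κ + α) by rw [eq_neg_iff_add_eq_zero, ← e1]; abel]; abel
      rw [this]
      exact add_mem hα' hα
  obtain ⟨F, hF1, hF⟩ := exists_dual_eq_one hnot
  have hFS : ∀ x ∈ K ⊔ A p, ∀ y ∈ I ⊔ A p, F (x, y) = 0 := fun x hx y hy =>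
    hF _ (Submodule.mem_sup_left ⟨hx, hy⟩)
  have hsplit : ∀ x, F (x, 0) - F (0, x) = F (D x) := fun x => by
    rw [← map_sub]; simp [D]
  have hfg : ∀ x ∈ A q, F (x, 0) = F (0, x) := fun x hx => by
    rw [← sub_eq_zero, hsplit]
    exact hF _ (Submodule.mem_sup_right ⟨x, hx, rfl⟩)
  have hf : ∀ x ∈ K, F (x, 0) = 0 := fun x hx =>
    hFS x (Submodule.mem_sup_left hx) 0 (zero_mem _)
  have hg : ∀ x ∈ I, F (0, x) = 0 := fun x hx =>
    hFS 0 (zero_mem _) x (Submodule.mem_sup_left hx)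
  refine hcon p q (by omega) hq3 k hk i hi hkA hiA hki (F ∘ₗ LinearMap.inl ℂ V V)
    (F ∘ₗ LinearMap.inr ℂ V V) hf hg
    (fun x hx => hFS x (Submodule.mem_sup_right hx) 0 (zero_mem _))
    (fun x hx => hFS 0 (zero_mem _) x (Submodule.mem_sup_right hx)) hfg hF1 ?_
  have h1 := hfg (k + i) (hA (show p + 1 ≤ q by omega) hki)
  have e1 : ((k + i, 0) : V × V) = (k, 0) + (i, 0) := by simp
  have e2 : ((0, k + i) : V × V) = (0, k) + (0, i) := by simp
  rw [e1, e2, map_add, map_add, hf k hk, hg i hi, hF1] at h1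
  simpa using h1

/-- The flag `0 ≤ im d ≤ ker c ≤ V`. -/
def endFlag (c : V →ₗ[ℂ] W) (d : W →ₗ[ℂ] V) : ℕ → Submodule ℂ V
  | 0 => ⊥
  | 1 => LinearMap.range d
  | 2 => LinearMap.ker c
  | _ => ⊤

theorem endFlag_monotone (c : V →ₗ[ℂ] W) (d : W →ₗ[ℂ] V) (hcd : ∀ u, c (d u) = 0) :
    Monotone (endFlag c d) := by
  refine monotone_nat_of_le_succ fun n => ?_
  match n with
  | 0 => exact bot_le
  | 1 => rintro _ ⟨u, rfl⟩; exact hcd u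
  | 2 => exact le_top
  | n + 3 => exact le_top

theorem endFlag_level (c : V →ₗ[ℂ] W) (d : W →ₗ[ℂ] V) {p : ℕ} {v : V} {φ : Module.Dual ℂ V}
    (hv : v ∈ endFlag c d (p + 1)) (hφ : ∀ x ∈ endFlag c d p, φ x = 0) :
    (∃ t, d t = v) ∨ (c v = 0 ∧ ∀ u, φ (d u) = 0) ∨ (∀ x, c x = 0 → φ x = 0) :=
  match p with
  | 0 => Or.inl hv
  | 1 => Or.inr (Or.inl ⟨hv, fun u => hφ _ ⟨u, rfl⟩⟩)
  | 2 => Or.inr (Or.inr hφ)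
  | _ + 3 => Or.inr (Or.inr fun x _ => hφ x trivial)

/-- Attaching an end vertex to a one-vector frame. -/
theorem exists_end_frame (c : V →ₗ[ℂ] W) (d : W →ₗ[ℂ] V) (hcd : ∀ u, c (d u) = 0)
    (v : V) (φ : Module.Dual ℂ V) (h : φ v = 1) (hv : d (c v) = 0) (hφ : ∀ x, φ (d (c x)) = 0)
    (hl : (∃ t, d t = v) ∨ (c v = 0 ∧ ∀ u, φ (d u) = 0) ∨ (∀ x, c x = 0 → φ x = 0)) :
    ∃ G : Frame W, (Frame.one v φ h).Maps G c ∧ G.Maps (Frame.one v φ h) d := by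
  rcases hl with ⟨t, rfl⟩ | ⟨h1, h2⟩ | h1
  · refine ⟨Frame.one t (φ ∘ₗ d) h, ⟨?_, ?_⟩, ⟨?_, ?_⟩⟩ <;> intro s <;> fin_cases s
    · simp only [Frame.one, Fin.zero_eta, Matrix.cons_val_fin_one, hcd]
      exact SmallComb.zero _
    · convert Submodule.zero_mem _
      ext x
      exact hφ x
    · exact SmallComb.mem _ (0 : Fin 1)
    · exact Submodule.subset_span ⟨(0 : Fin 1), rfl⟩
  · refine ⟨Frame.nil W, Frame.maps_to_nil _ _ ?_, Frame.maps_nil _ _ ?_⟩ <;> intro s <;>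
      fin_cases s
    · exact h1
    · exact h2
  · obtain ⟨χ, hχ⟩ := exists_dual_comp_eq c φ h1
    refine ⟨Frame.one (c v) χ (by rw [← h, ← hχ]; rfl), ⟨?_, ?_⟩, ⟨?_, ?_⟩⟩ <;> intro s <;>
      fin_cases s
    · exact SmallComb.mem _ (0 : Fin 1)
    · simp only [Frame.one, Fin.zero_eta, Matrix.cons_val_fin_one, hχ]
      exact Submodule.subset_span ⟨(0 : Fin 1), rfl⟩
    · simp only [Frame.one, Fin.zero_eta, Matrix.cons_val_fin_one, hv]
      exact SmallComb.zero _
    · convert Submodule.zero_mem _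
      ext x
      exact h1 _ (hcd x)

end Frames

/-- Representations of the preprojective algebra of type `A₄`. -/
structure PreprojRep (V₁ V₂ V₃ V₄ : Type) [AddCommGroup V₁] [Module ℂ V₁] [AddCommGroup V₂]
    [Module ℂ V₂] [AddCommGroup V₃] [Module ℂ V₃] [AddCommGroup V₄] [Module ℂ V₄] where
  a₁ : V₁ →ₗ[ℂ] V₂
  a₂ : V₂ →ₗ[ℂ] V₃
  a₃ : V₃ →ₗ[ℂ] V₄
  b₁ : V₂ →ₗ[ℂ] V₁
  b₂ : V₃ →ₗ[ℂ] V₂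
  b₃ : V₄ →ₗ[ℂ] V₃
  rel₁ : ∀ v, b₁ (a₁ v) = 0
  rel₂ : ∀ v, a₁ (b₁ v) = b₂ (a₂ v)
  rel₃ : ∀ v, b₃ (a₃ v) = a₂ (b₂ v)
  rel₄ : ∀ v, a₃ (b₃ v) = 0

namespace PreprojRep

variable {V₁ V₂ V₃ V₄ : Type} [AddCommGroup V₁] [Module ℂ V₁] [AddCommGroup V₂]
    [Module ℂ V₂] [AddCommGroup V₃] [Module ℂ V₃] [AddCommGroup V₄] [Module ℂ V₄]

/-- The representation obtained by reversing the order of the vertices. -/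
def flip (R : PreprojRep V₁ V₂ V₃ V₄) : PreprojRep V₄ V₃ V₂ V₁ where
  a₁ := R.b₃
  a₂ := R.b₂
  a₃ := R.b₁
  b₁ := R.a₃
  b₂ := R.a₂
  b₃ := R.a₁
  rel₁ := R.rel₄
  rel₂ := R.rel₃
  rel₃ := R.rel₂
  rel₄ := R.rel₁

/-- A nonzero direct summand of dimension vector at most `(2, 2, 2, 2)` with small structure
constants. -/
def HasSummand (R : PreprojRep V₁ V₂ V₃ V₄) : Prop :=
  ∃ (F₁ : Frame V₁) (F₂ : Frame V₂) (F₃ : Frame V₃) (F₄ : Frame V₄),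
    0 < F₁.n + F₂.n + F₃.n + F₄.n ∧ F₁.Maps F₂ R.a₁ ∧ F₂.Maps F₃ R.a₂ ∧ F₃.Maps F₄ R.a₃ ∧
      F₂.Maps F₁ R.b₁ ∧ F₃.Maps F₂ R.b₂ ∧ F₄.Maps F₃ R.b₃

theorem HasSummand.flip {R : PreprojRep V₁ V₂ V₃ V₄} (h : R.flip.HasSummand) : R.HasSummand := by
  obtain ⟨F₁, F₂, F₃, F₄, hn, h1, h2, h3, h4, h5, h6⟩ := h
  exact ⟨F₄, F₃, F₂, F₁, by omega, h6, h5, h4, h3, h2, h1⟩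

theorem exists_left_frame (R : PreprojRep V₁ V₂ V₃ V₄) (v : V₂) (ψ : Module.Dual ℂ V₂)
    (h : ψ (R.b₂ (R.a₂ v)) = 1) :
    ∃ (h₁ : (ψ ∘ₗ R.b₂ ∘ₗ R.a₂) v = 1) (h₂ : (ψ ∘ₗ R.b₂ ∘ₗ R.a₂) (R.b₂ (R.a₂ v)) = 0)
      (F : Frame V₁),
      F.Maps (.two v (R.b₂ (R.a₂ v)) (ψ ∘ₗ R.b₂ ∘ₗ R.a₂) ψ h₁ h₂ h) R.a₁ ∧
      (Frame.two v (R.b₂ (R.a₂ v)) (ψ ∘ₗ R.b₂ ∘ₗ R.a₂) ψ h₁ h₂ h).Maps F R.b₁ := by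
  have hz : ∀ x, R.b₁ (R.b₂ (R.a₂ x)) = 0 := fun x => by rw [← R.rel₂, R.rel₁]
  have hz' : ∀ x, R.b₂ (R.a₂ (R.a₁ x)) = 0 := fun x => by rw [← R.rel₂, R.rel₁, map_zero]
  refine ⟨h, ?_, .one (R.b₁ v) (ψ ∘ₗ R.a₁) ?_, ⟨?_, ?_⟩, ⟨?_, ?_⟩⟩
  · simp [← R.rel₂, R.rel₁]
  · simpa [R.rel₂] using h
  · intro s
    fin_cases s
    simp only [Frame.one, Fin.zero_eta, Matrix.cons_val_fin_one, R.rel₂]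
    exact SmallComb.mem _ (1 : Fin 2)
  · refine Fin.forall_fin_two.2 ⟨?_, ?_⟩
    · convert Submodule.zero_mem _
      ext x
      simp [Frame.two, hz']
    · exact Submodule.subset_span ⟨(0 : Fin 1), rfl⟩
  · refine Fin.forall_fin_two.2 ⟨?_, ?_⟩
    · exact SmallComb.mem _ (0 : Fin 1)
    · simp only [Frame.two, Matrix.cons_val_one, Matrix.cons_val_fin_one, hz]
      exact SmallComb.zero _
  · intro s
    fin_cases s
    refine Submodule.subset_span ⟨(0 : Fin 2), ?_⟩
    ext x
    simp [Frame.two, Frame.one, R.rel₂]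

theorem hasSummand_of_long (R : PreprojRep V₁ V₂ V₃ V₄) (v : V₂)
    (hv : R.a₂ (R.b₂ (R.a₂ v)) ≠ 0) : R.HasSummand := by
  have z2 : ∀ x, R.b₂ (R.a₂ (R.b₂ (R.a₂ x))) = 0 := fun x => by
    rw [← R.rel₂, ← R.rel₂, R.rel₁, map_zero]
  obtain ⟨χ, hχ, -⟩ := exists_dual_eq_one (p := ⊥) (by simpa using hv)
  obtain ⟨h₁, h₂, F₁, hF, hF'⟩ := R.exists_left_frame v (χ ∘ₗ R.a₂) hχ
  have h3 : χ (R.b₃ (R.a₃ (R.a₂ v))) = 1 := by rw [R.rel₃]; exact hχ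
  refine ⟨F₁, _, .two (R.a₂ v) (R.a₂ (R.b₂ (R.a₂ v))) (χ ∘ₗ R.a₂ ∘ₗ R.b₂) χ hχ ?_ hχ,
    .one (R.a₃ (R.a₂ v)) (χ ∘ₗ R.b₃) h3, ?_, hF, ⟨?_, ?_⟩, ⟨?_, ?_⟩, hF', ⟨?_, ?_⟩, ⟨?_, ?_⟩⟩
  · simp [z2]
  · simp [Frame.two]
  · exact Fin.forall_fin_two.2 ⟨SmallComb.mem _ (0 : Fin 2), SmallComb.mem _ (1 : Fin 2)⟩
  · exact Fin.forall_fin_two.2 ⟨Submodule.subset_span ⟨(0 : Fin 2), rfl⟩,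
      Submodule.subset_span ⟨(1 : Fin 2), rfl⟩⟩
  · refine Fin.forall_fin_two.2 ⟨SmallComb.mem _ (0 : Fin 1), ?_⟩
    simp only [Frame.two, Matrix.cons_val_one, Matrix.cons_val_fin_one, ← R.rel₃, R.rel₄]
    exact SmallComb.zero _
  · intro s
    fin_cases s
    refine Submodule.subset_span ⟨(0 : Fin 2), ?_⟩
    ext x
    simp [Frame.two, Frame.one, R.rel₃]
  · refine Fin.forall_fin_two.2 ⟨SmallComb.mem _ (1 : Fin 2), ?_⟩
    simp only [Frame.two, Matrix.cons_val_one, Matrix.cons_val_fin_one, z2]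
    exact SmallComb.zero _
  · refine Fin.forall_fin_two.2 ⟨?_, Submodule.subset_span ⟨(0 : Fin 2), rfl⟩⟩
    convert Submodule.zero_mem _
    ext x
    simp [Frame.two, ← R.rel₃, R.rel₄]
  · intro s
    fin_cases s
    simp only [Frame.one, Fin.zero_eta, Matrix.cons_val_fin_one, R.rel₃]
    exact SmallComb.mem _ (1 : Fin 2)
  · refine Fin.forall_fin_two.2 ⟨?_, Submodule.subset_span ⟨(0 : Fin 1), rfl⟩⟩
    convert Submodule.zero_mem _
    ext x
    simp [Frame.two, ← R.rel₃, R.rel₄]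

/-- The summand on which `ker b₂` and `im a₂` differ and whose part at the third vertex has
dimension two. -/
theorem hasSummand_of_pair (R : PreprojRep V₁ V₂ V₃ V₄)
    (h0 : ∀ x, R.a₂ (R.b₂ (R.a₂ x)) = 0) (h0' : ∀ x, R.b₂ (R.a₂ (R.b₂ x)) = 0) {p q : ℕ} (hpq : p < q) (hq : q < 3) {k : V₃} {v : V₂}
    (hk : R.b₂ k = 0) (hkq : k ∈ endFlag R.a₃ R.b₃ (q + 1))
    (hvq : R.a₂ v ∈ endFlag R.a₃ R.b₃ (q + 1)) (hkv : k + R.a₂ v ∈ endFlag R.a₃ R.b₃ (p + 1))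
    {ψ : Module.Dual ℂ V₂} {g : Module.Dual ℂ V₃} (hg : ∀ x, g (R.a₂ x) = 0)
    (hψp : ∀ x ∈ endFlag R.a₃ R.b₃ p, ψ (R.b₂ x) = 0) (hgp : ∀ x ∈ endFlag R.a₃ R.b₃ p, g x = 0)
    (hψg : ∀ x ∈ endFlag R.a₃ R.b₃ q, ψ (R.b₂ x) = g x) (hgk : g k = 1)
    (hψv : ψ (R.b₂ (R.a₂ v)) = 1) : R.HasSummand := by
  obtain ⟨h₁, h₂, F₁, hF, hF'⟩ := R.exists_left_frame v ψ hψv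
  let F₃ : Frame V₃ := .two k (R.a₂ v) g (ψ ∘ₗ R.b₂) hgk (hg v) hψv
  have hψk : ψ (R.b₂ k) = 0 := by rw [hk, map_zero]
  suffices ∃ F₄ : Frame V₄, F₃.Maps F₄ R.a₃ ∧ F₄.Maps F₃ R.b₃ by
    obtain ⟨F₄, h, h'⟩ := this
    refine ⟨F₁, _, F₃, F₄, ?_, hF, ⟨?_, ?_⟩, h, hF', ⟨?_, ?_⟩, h'⟩
    · simp [F₃, Frame.two]
    · refine Fin.forall_fin_two.2 ⟨SmallComb.mem _ (1 : Fin 2), ?_⟩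
      simp only [Frame.two, Matrix.cons_val_one, Matrix.cons_val_fin_one, h0]
      exact SmallComb.zero _
    · refine Fin.forall_fin_two.2 ⟨?_, Submodule.subset_span ⟨(0 : Fin 2), rfl⟩⟩
      convert Submodule.zero_mem _
      ext x
      simp [F₃, Frame.two, hg]
    · refine Fin.forall_fin_two.2 ⟨?_, SmallComb.mem _ (1 : Fin 2)⟩
      simp only [F₃, Frame.two, Matrix.cons_val_zero, hk]
      exact SmallComb.zero _
    · refine Fin.forall_fin_two.2 ⟨?_, Submodule.subset_span ⟨(1 : Fin 2), rfl⟩⟩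
      convert Submodule.zero_mem _
      ext x
      simp [Frame.two, h0']
  have hga : ∀ x, g (R.b₃ (R.a₃ x)) = 0 := fun x => by rw [R.rel₃, hg]
  have hgk3 : g (k + R.a₂ v) = 1 := by rw [map_add, hg, hgk, add_zero]
  have hba : ∀ x, R.b₂ x = 0 → R.b₃ (R.a₃ x) = 0 := fun x hx => by rw [R.rel₃, hx, map_zero]
  have hker : R.a₃ (R.a₂ v) = -R.a₃ k := by
    have : k + R.a₂ v ∈ endFlag R.a₃ R.b₃ 2 :=
      endFlag_monotone R.a₃ R.b₃ R.rel₄ (show p + 1 ≤ 2 by omega) hkv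
    rw [eq_neg_iff_add_eq_zero, ← map_add, add_comm]
    exact this
  obtain ⟨rfl, rfl⟩ | ⟨rfl, rfl⟩ | ⟨rfl, rfl⟩ :
      (p = 0 ∧ q = 1) ∨ (p = 0 ∧ q = 2) ∨ (p = 1 ∧ q = 2) := by omega
  · obtain ⟨t, ht⟩ := hkv
    have ht1 : (g ∘ₗ R.b₃) t = 1 := by simpa [ht] using hgk3
    have hk3 : R.a₃ k = 0 := hkq
    refine ⟨.one t (g ∘ₗ R.b₃) ht1, ⟨?_, ?_⟩, ?_, ?_⟩
    · refine Fin.forall_fin_two.2 ⟨?_, ?_⟩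
      · simp only [F₃, Frame.two, Matrix.cons_val_zero, hk3]
        exact SmallComb.zero _
      · simp only [F₃, Frame.two, Matrix.cons_val_one, Matrix.cons_val_fin_one, hker, hk3, neg_zero]
        exact SmallComb.zero _
    · intro s
      fin_cases s
      convert Submodule.zero_mem _
      ext x
      simp [Frame.one, hga]
    · intro s
      fin_cases s
      simp only [Frame.one, Fin.zero_eta, Matrix.cons_val_fin_one, ht]
      exact smallComb_pair_add _ _
    · refine Fin.forall_fin_two.2 ⟨Submodule.subset_span ⟨(0 : Fin 1), rfl⟩,
        Submodule.subset_span ⟨(0 : Fin 1), ?_⟩⟩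
      ext u
      exact (hψg _ ⟨u, rfl⟩).symm
  · obtain ⟨t, ht⟩ := hkv
    have ht1 : (g ∘ₗ R.b₃) t = 1 := by simpa [ht] using hgk3
    obtain ⟨χ, hχ⟩ := exists_dual_comp_eq R.a₃ (g - ψ ∘ₗ R.b₂)
      (fun x hx => by simp [hψg x hx])
    have hχ' : ∀ x, χ (R.a₃ x) = g x - ψ (R.b₂ x) := fun x => LinearMap.congr_fun hχ x
    refine ⟨.two t (R.a₃ k) (g ∘ₗ R.b₃) χ ht1 (hga k) (by rw [hχ', hgk, hψk, sub_zero]),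
      ⟨?_, ?_⟩, ?_, ?_⟩
    · refine Fin.forall_fin_two.2 ⟨SmallComb.mem _ (1 : Fin 2), ?_⟩
      simp only [F₃, Frame.two, Matrix.cons_val_one, Matrix.cons_val_fin_one, hker]
      exact (SmallComb.mem _ (1 : Fin 2)).neg
    · refine Fin.forall_fin_two.2 ⟨?_, ?_⟩
      · convert Submodule.zero_mem _
        ext x
        simp [Frame.two, hga]
      · simp only [Frame.two, Matrix.cons_val_one, Matrix.cons_val_fin_one, hχ]
        exact sub_mem (Submodule.subset_span ⟨(0 : Fin 2), rfl⟩)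
          (Submodule.subset_span ⟨(1 : Fin 2), rfl⟩)
    · refine Fin.forall_fin_two.2 ⟨?_, ?_⟩
      · simp only [Frame.two, Matrix.cons_val_zero, ht]
        exact smallComb_pair_add _ _
      · simp only [Frame.two, Matrix.cons_val_one, Matrix.cons_val_fin_one, hba k hk]
        exact SmallComb.zero _
    · have : ∀ u, ψ (R.b₂ (R.b₃ u)) = g (R.b₃ u) := fun u => hψg _ (R.rel₄ u)
      refine Fin.forall_fin_two.2 ⟨Submodule.subset_span ⟨(0 : Fin 2), rfl⟩,
        Submodule.subset_span ⟨(0 : Fin 2), ?_⟩⟩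
      ext u
      exact (this u).symm
  · obtain ⟨χ, hχ⟩ := exists_dual_comp_eq R.a₃ (g - ψ ∘ₗ R.b₂)
      (fun x hx => by simp [hψg x hx])
    have hχ' : ∀ x, χ (R.a₃ x) = g x - ψ (R.b₂ x) := fun x => LinearMap.congr_fun hχ x
    refine ⟨.one (R.a₃ k) χ (by rw [hχ', hgk, hψk, sub_zero]), ⟨?_, ?_⟩, ?_, ?_⟩
    · refine Fin.forall_fin_two.2 ⟨SmallComb.mem _ (0 : Fin 1), ?_⟩
      simp only [F₃, Frame.two, Matrix.cons_val_one, Matrix.cons_val_fin_one, hker]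
      exact (SmallComb.mem _ (0 : Fin 1)).neg
    · intro s
      fin_cases s
      simp only [Frame.one, Fin.zero_eta, Matrix.cons_val_fin_one, hχ]
      exact sub_mem (Submodule.subset_span ⟨(0 : Fin 2), rfl⟩)
        (Submodule.subset_span ⟨(1 : Fin 2), rfl⟩)
    · intro s
      fin_cases s
      simp only [Frame.one, Fin.zero_eta, Matrix.cons_val_fin_one, hba k hk]
      exact SmallComb.zero _
    · refine Fin.forall_fin_two.2 ⟨?_, ?_⟩
      · convert Submodule.zero_mem _
        ext u
        exact hgp _ ⟨u, rfl⟩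
      · convert Submodule.zero_mem _
        ext u
        exact hψp _ ⟨u, rfl⟩

theorem ker_eq_range_or_hasSummand (R : PreprojRep V₁ V₂ V₃ V₄)
    (h0 : ∀ x, R.a₂ (R.b₂ (R.a₂ x)) = 0) (h0' : ∀ x, R.b₂ (R.a₂ (R.b₂ x)) = 0) :
    LinearMap.ker R.b₂ = LinearMap.range R.a₂ ∨ R.HasSummand := by
  refine or_iff_not_imp_left.2 fun hne => ?_
  rcases exists_summand_of_ne hne (endFlag_monotone R.a₃ R.b₃ R.rel₄) rfl rfl with
    ⟨p, k, hk, hkp, hkn⟩ | ⟨p, _, ⟨v, rfl⟩, hvp, hvn⟩ |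
    ⟨p, q, hpq, hq, k, hk, _, ⟨v, rfl⟩, hkq, hvq, hkv, f, g, hfK, hgI, hfp, hgp, hfg, hgk, hfv⟩
  · obtain ⟨φ, hφ, hφ0⟩ := exists_dual_eq_one hkn
    have hφI : ∀ x, φ (R.a₂ x) = 0 := fun x => hφ0 _ (Submodule.mem_sup_left ⟨x, rfl⟩)
    have hk' : R.b₂ k = 0 := hk
    obtain ⟨G, hG, hG'⟩ := exists_end_frame R.a₃ R.b₃ R.rel₄ k φ hφ
      (by rw [R.rel₃, hk', map_zero]) (fun x => by rw [R.rel₃, hφI])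
      (endFlag_level _ _ hkp fun x hx => hφ0 x (Submodule.mem_sup_right hx))
    refine ⟨.nil _, .nil _, .one k φ hφ, G, ?_, Frame.maps_nil_nil _, Frame.maps_nil _ _ ?_, hG,
      Frame.maps_nil_nil _, Frame.maps_to_nil _ _ ?_, hG'⟩
    · simp only [Frame.one]; omega
    · intro s
      fin_cases s
      exact hφI
    · intro s
      fin_cases s
      exact hk
  · obtain ⟨φ, hφ, hφ0⟩ := exists_dual_eq_one hvn
    obtain ⟨ψ, rfl⟩ := exists_dual_comp_eq R.b₂ φ
      fun x hx => hφ0 x (Submodule.mem_sup_left hx)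
    obtain ⟨h₁, h₂, F₁, hF, hF'⟩ := R.exists_left_frame v ψ hφ
    obtain ⟨G, hG, hG'⟩ := exists_end_frame R.a₃ R.b₃ R.rel₄ (R.a₂ v) (ψ ∘ₗ R.b₂) hφ
      (by rw [R.rel₃, h0]) (fun x => by simp [R.rel₃, h0'])
      (endFlag_level _ _ hvp fun x hx => hφ0 x (Submodule.mem_sup_right hx))
    refine ⟨F₁, _, .one (R.a₂ v) (ψ ∘ₗ R.b₂) hφ, G, ?_, hF, ⟨?_, ?_⟩, hG, hF', ⟨?_, ?_⟩, hG'⟩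
    · simp only [Frame.one]; omega
    · refine Fin.forall_fin_two.2 ⟨SmallComb.mem _ (0 : Fin 1), ?_⟩
      simp only [Frame.two, Matrix.cons_val_one, Matrix.cons_val_fin_one, h0]
      exact SmallComb.zero _
    · intro s
      fin_cases s
      exact Submodule.subset_span ⟨(0 : Fin 2), rfl⟩
    · intro s
      fin_cases s
      exact SmallComb.mem _ (1 : Fin 2)
    · refine Fin.forall_fin_two.2 ⟨?_, Submodule.subset_span ⟨(0 : Fin 1), rfl⟩⟩
      convert Submodule.zero_mem _
      ext x
      simp [Frame.two, h0']
  · obtain ⟨ψ, rfl⟩ := exists_dual_comp_eq R.b₂ f hfK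
    exact R.hasSummand_of_pair h0 h0' hpq hq hk hkq hvq hkv (fun x => hgI _ ⟨x, rfl⟩) hfp hgp hfg
      hgk hfv

theorem hasSummand_of_middle (R : PreprojRep V₁ V₂ V₃ V₄) (h : ∀ x, R.b₂ (R.a₂ x) = 0)
    (h' : ∀ x, R.a₂ (R.b₂ x) = 0) (hb : ∃ w, R.b₂ w ≠ 0) : R.HasSummand := by
  classical
  have hp : ∃ p, ∃ w ∈ endFlag R.a₃ R.b₃ p, R.b₂ w ≠ 0 := by
    obtain ⟨w, hw⟩ := hb
    exact ⟨3, w, trivial, hw⟩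
  obtain ⟨p, hpp⟩ : ∃ p, Nat.find hp = p + 1 := by
    refine Nat.exists_eq_succ_of_ne_zero fun h => ?_
    obtain ⟨w, hw, hbw⟩ := Nat.find_spec hp
    rw [h] at hw
    have : w = 0 := hw
    exact hbw (by rw [this, map_zero])
  have hpmin := Nat.find_min hp (m := p) (by omega)
  push Not at hpmin
  have hq : ∃ q, ∃ w ∈ endFlag R.a₃ R.b₃ (p + 1), R.b₂ w ≠ 0 ∧ R.b₂ w ∈ endFlag R.b₁ R.a₁ q := by
    obtain ⟨w, hw, hbw⟩ := Nat.find_spec hp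
    rw [hpp] at hw
    exact ⟨3, w, hw, hbw, trivial⟩
  obtain ⟨q, hqq⟩ : ∃ q, Nat.find hq = q + 1 := by
    refine Nat.exists_eq_succ_of_ne_zero fun h => ?_
    obtain ⟨w, -, hbw, hbq⟩ := Nat.find_spec hq
    rw [h] at hbq
    exact hbw hbq
  have hqmin := Nat.find_min hq (m := q) (by omega)
  obtain ⟨w, hw, hbw, hbq⟩ := Nat.find_spec hq
  rw [hqq] at hbq
  obtain ⟨φ, hφ, hφ0⟩ := exists_dual_eq_one fun hmem => hqmin ⟨w, hw, hbw, hmem⟩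
  obtain ⟨G, hG, hG'⟩ := exists_end_frame R.a₃ R.b₃ R.rel₄ w (φ ∘ₗ R.b₂) hφ
    (by rw [R.rel₃, h']) (fun x => by simp [R.rel₃, h'])
    (endFlag_level _ _ hw fun x hx => by simp [hpmin x hx])
  obtain ⟨F, hF, hF'⟩ := exists_end_frame R.b₁ R.a₁ R.rel₁ (R.b₂ w) φ hφ
    (by rw [R.rel₂, h']; simp) (fun x => by simp [R.rel₂, h])
    (endFlag_level _ _ hbq hφ0)
  refine ⟨F, _, _, G, ?_, hF', ⟨?_, ?_⟩, hG, hF, ⟨?_, ?_⟩, hG'⟩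
  · simp only [Frame.one]; omega
  all_goals intro s; fin_cases s
  · simp only [Frame.one, Fin.zero_eta, Matrix.cons_val_fin_one, h']
    exact SmallComb.zero _
  · convert Submodule.zero_mem _
    ext x
    simp [Frame.one, h]
  · exact SmallComb.mem _ (0 : Fin 1)
  · exact Submodule.subset_span ⟨(0 : Fin 1), rfl⟩

theorem hasSummand_of_simple (R : PreprojRep V₁ V₂ V₃ V₄) (h : ∀ x : V₂, x = 0) (v : V₁)
    (hv : v ≠ 0) : R.HasSummand := by
  obtain ⟨φ, hφ, -⟩ := exists_dual_eq_one (p := ⊥) (by simpa using hv)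
  refine ⟨.one v φ hφ, .nil _, .nil _, .nil _, by simp [Frame.one], Frame.maps_to_nil _ _ ?_,
    Frame.maps_nil_nil _, Frame.maps_nil_nil _, Frame.maps_nil _ _ ?_, Frame.maps_nil_nil _,
    Frame.maps_nil_nil _⟩
  · exact fun s => h _
  · intro t x
    rw [h x, map_zero, map_zero]

theorem hasSummand (R : PreprojRep V₁ V₂ V₃ V₄)
    (hne : (∃ v : V₁, v ≠ 0) ∨ (∃ v : V₂, v ≠ 0) ∨ (∃ v : V₃, v ≠ 0) ∨ ∃ v : V₄, v ≠ 0) :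
    R.HasSummand := by
  by_contra hR
  have hR' : ¬ R.flip.HasSummand := fun h => hR h.flip
  have h0 : ∀ x, R.a₂ (R.b₂ (R.a₂ x)) = 0 := fun x => by
    by_contra hx; exact hR (R.hasSummand_of_long x hx)
  have h0' : ∀ x, R.b₂ (R.a₂ (R.b₂ x)) = 0 := fun x => by
    by_contra hx; exact hR' (R.flip.hasSummand_of_long x hx)
  have hb : LinearMap.ker R.b₂ = LinearMap.range R.a₂ :=
    (R.ker_eq_range_or_hasSummand h0 h0').resolve_right hR
  have ha : LinearMap.ker R.a₂ = LinearMap.range R.b₂ :=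
    (R.flip.ker_eq_range_or_hasSummand h0' h0).resolve_right hR'
  have hba : ∀ x, R.b₂ (R.a₂ x) = 0 := fun x => hb.ge ⟨x, rfl⟩
  have hab : ∀ x, R.a₂ (R.b₂ x) = 0 := fun x => ha.ge ⟨x, rfl⟩
  have hb0 : ∀ x, R.b₂ x = 0 := fun x => by
    by_contra hx; exact hR (R.hasSummand_of_middle hba hab ⟨x, hx⟩)
  have ha0 : ∀ x, R.a₂ x = 0 := fun x => by
    by_contra hx; exact hR' (R.flip.hasSummand_of_middle hab hba ⟨x, hx⟩)
  have h3 : ∀ x : V₃, x = 0 := fun x => by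
    obtain ⟨y, rfl⟩ := hb.le (hb0 x)
    exact ha0 y
  have h2 : ∀ x : V₂, x = 0 := fun x => by
    obtain ⟨y, rfl⟩ := ha.le (ha0 x)
    exact hb0 y
  rcases hne with ⟨v, hv⟩ | ⟨v, hv⟩ | ⟨v, hv⟩ | ⟨v, hv⟩
  · exact hR (R.hasSummand_of_simple h2 v hv)
  · exact hv (h2 v)
  · exact hv (h3 v)
  · exact hR' (R.flip.hasSummand_of_simple h3 v hv)

end PreprojRep

namespace E2Mod

variable (M : E2Mod)

variable {M} in
theorem mem_wt {k : ℤ} {v : M.V} : v ∈ M.wt k ↔ M.L v = (k : ℂ) • v := by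
  simp [wt, sub_eq_zero]

theorem Pm_Pp (v : M.V) : M.Pm (M.Pp v) = M.Pp (M.Pm v) :=
  (LinearMap.congr_fun M.comm v).symm

theorem Pp_mem_wt {k l : ℤ} (h : l = k + 1) (v : M.V) (hv : v ∈ M.wt k) : M.Pp v ∈ M.wt l := by
  have h1 := LinearMap.congr_fun M.relp v
  simp only [LinearMap.sub_apply, LinearMap.comp_apply, mem_wt.1 hv, map_smul] at h1
  rw [mem_wt, eq_add_of_sub_eq h1, h]
  push_cast
  module

theorem Pm_mem_wt {k l : ℤ} (h : k = l + 1) (v : M.V) (hv : v ∈ M.wt k) : M.Pm v ∈ M.wt l := by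
  have h1 := LinearMap.congr_fun M.relm v
  simp only [LinearMap.sub_apply, LinearMap.comp_apply, mem_wt.1 hv, map_smul,
    LinearMap.neg_apply] at h1
  rw [mem_wt, eq_add_of_sub_eq h1, h]
  push_cast
  module

/-- `P₊` as a map between weight spaces. -/
def raise {k l : ℤ} (h : l = k + 1) : M.wt k →ₗ[ℂ] M.wt l :=
  M.Pp.restrict (M.Pp_mem_wt h)

/-- `P₋` as a map between weight spaces. -/
def lower {k l : ℤ} (h : k = l + 1) : M.wt k →ₗ[ℂ] M.wt l :=
  M.Pm.restrict (M.Pm_mem_wt h)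

variable {M} in
theorem hom_ext {W : Type} [AddCommGroup W] [Module ℂ W] {f g : M.V →ₗ[ℂ] W}
    (h : ∀ k, ∀ v ∈ M.wt k, f v = g v) : f = g := by
  have htop : (⨆ k, M.wt k) = ⊤ := M.internal.submodule_iSup_eq_top
  have hle : (⨆ k, M.wt k) ≤ LinearMap.eqLocus f g := iSup_le fun k v hv => h k v hv
  rw [htop] at hle
  exact LinearMap.ext fun v => hle trivial

/-- The projection onto a weight space. -/
noncomputable def proj (k : ℤ) : M.V →ₗ[ℂ] M.wt k :=
  DirectSum.component ℂ ℤ (fun k => M.wt k) k ∘ₗ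
    (LinearEquiv.ofBijective (DirectSum.coeLinearMap M.wt) M.internal).symm.toLinearMap

theorem proj_coe (k : ℤ) (v : M.wt k) : M.proj k v = v :=
  DirectSum.IsInternal.ofBijective_coeLinearMap_same (A := M.wt) M.internal v

theorem proj_of_mem {k : ℤ} (v : M.V) (hv : v ∈ M.wt k) : M.proj k v = ⟨v, hv⟩ :=
  M.proj_coe k ⟨v, hv⟩

theorem proj_of_ne {k l : ℤ} (h : k ≠ l) (v : M.V) (hv : v ∈ M.wt k) : M.proj l v = 0 :=
  DirectSum.IsInternal.ofBijective_coeLinearMap_of_ne (A := M.wt) M.internal h ⟨v, hv⟩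

theorem proj_comp_L (k : ℤ) : M.proj k ∘ₗ M.L = (k : ℂ) • M.proj k := by
  refine hom_ext fun l v hv => ?_
  rw [LinearMap.comp_apply, mem_wt.1 hv, map_smul, LinearMap.smul_apply]
  rcases eq_or_ne l k with rfl | h
  · rfl
  · rw [M.proj_of_ne h v hv, smul_zero, smul_zero]

theorem proj_comp_Pp {k l : ℤ} (h : l = k + 1) : M.proj l ∘ₗ M.Pp = M.raise h ∘ₗ M.proj k := by
  refine hom_ext fun j v hv => ?_
  rw [LinearMap.comp_apply, LinearMap.comp_apply]
  rcases eq_or_ne j k with rfl | hj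
  · rw [M.proj_of_mem _ (M.Pp_mem_wt h v hv), M.proj_of_mem v hv]
    rfl
  · rw [M.proj_of_ne (show j + 1 ≠ l by omega) _ (M.Pp_mem_wt rfl v hv), M.proj_of_ne hj v hv,
      map_zero]

theorem proj_comp_Pm {k l : ℤ} (h : k = l + 1) : M.proj l ∘ₗ M.Pm = M.lower h ∘ₗ M.proj k := by
  refine hom_ext fun j v hv => ?_
  rw [LinearMap.comp_apply, LinearMap.comp_apply]
  rcases eq_or_ne j k with rfl | hj
  · rw [M.proj_of_mem _ (M.Pm_mem_wt h v hv), M.proj_of_mem v hv]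
    rfl
  · rw [M.proj_of_ne (show j - 1 ≠ l by omega) _ (M.Pm_mem_wt (by omega) v hv),
      M.proj_of_ne hj v hv, map_zero]

theorem exists_ne_zero_wt (h : ∃ v : M.V, v ≠ 0) : ∃ k, ∃ v : M.wt k, v ≠ 0 := by
  by_contra! hall
  obtain ⟨v, hv⟩ := h
  have : (LinearMap.id : M.V →ₗ[ℂ] M.V) = 0 := hom_ext fun k v hv => by
    simpa using congrArg Subtype.val (hall k ⟨v, hv⟩)
  exact hv (LinearMap.congr_fun this v)

variable {M} in
/-- The representation of the preprojective algebra of type `A₄` given by the weight spaces of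
a module with weights in `[a, a + 3]`. -/
def rep {a : ℤ} (h : ∀ k : ℤ, k < a ∨ a + 3 < k → M.wt k = ⊥) :
    PreprojRep (M.wt a) (M.wt (a + 1)) (M.wt (a + 2)) (M.wt (a + 3)) where
  a₁ := M.raise rfl
  a₂ := M.raise (by ring)
  a₃ := M.raise (by ring)
  b₁ := M.lower rfl
  b₂ := M.lower (by ring)
  b₃ := M.lower (by ring)
  rel₁ v := by
    have h1 : M.Pm (v : M.V) = 0 := by
      have := M.Pm_mem_wt (l := a - 1) (by ring) v v.2
      rwa [h (a - 1) (by omega), Submodule.mem_bot] at this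
    ext
    simp [raise, lower, M.Pm_Pp, h1]
  rel₂ v := by
    ext
    simp [raise, lower, M.Pm_Pp]
  rel₃ v := by
    ext
    simp [raise, lower, M.Pm_Pp]
  rel₄ v := by
    have h1 : M.Pp (v : M.V) = 0 := by
      have := M.Pp_mem_wt (l := a + 4) (by ring) v v.2
      rwa [h (a + 4) (by omega), Submodule.mem_bot] at this
    ext
    simp [raise, lower, ← M.Pm_Pp, h1]

variable {M} in
theorem Indecomposable.isBasis_of_gram (hM : M.Indecomposable) {ι : Type} [Fintype ι] [Nonempty ι]
    {e : ι → M.V} {φ : ι → Module.Dual ℂ M.V}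
    (hg : ∀ c : ι → ℂ, (∀ i, ∑ j, c j * φ i (e j) = 0) → c = 0)
    (hP : ∀ T ∈ ({M.Pp, M.Pm, M.L} : Set (M.V →ₗ[ℂ] M.V)),
      (∀ i, T (e i) ∈ Submodule.span ℂ (Set.range e)) ∧
        ∀ i, φ i ∘ₗ T ∈ Submodule.span ℂ (Set.range φ)) :
    LinearIndependent ℂ e ∧ ⊤ ≤ Submodule.span ℂ (Set.range e) := by
  classical
  set W₁ := Submodule.span ℂ (Set.range e) with hW₁
  set W₂ := (Submodule.span ℂ (Set.range φ)).dualCoannihilator with hW₂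
  have memW₂ : ∀ v, v ∈ W₂ ↔ ∀ i, φ i v = 0 := fun v => by
    rw [hW₂, Submodule.mem_dualCoannihilator]
    refine ⟨fun h i => h _ (Submodule.subset_span ⟨i, rfl⟩), fun h f hf => ?_⟩
    have : Submodule.span ℂ (Set.range φ) ≤ LinearMap.ker (Module.Dual.eval ℂ M.V v) :=
      Submodule.span_le.2 (by rintro _ ⟨i, rfl⟩; exact h i)
    exact this hf
  have inv₁ : ∀ T ∈ ({M.Pp, M.Pm, M.L} : Set (M.V →ₗ[ℂ] M.V)), ∀ v ∈ W₁, T v ∈ W₁ :=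
    fun T hT => by
      have : W₁ ≤ W₁.comap T := Submodule.span_le.2 (by rintro _ ⟨i, rfl⟩; exact (hP T hT).1 i)
      exact this
  have inv₂ : ∀ T ∈ ({M.Pp, M.Pm, M.L} : Set (M.V →ₗ[ℂ] M.V)), ∀ v ∈ W₂, T v ∈ W₂ :=
    fun T hT v hv => (memW₂ _).2 fun i => (Submodule.mem_dualCoannihilator _).1 hv _ ((hP T hT).2 i)
  have hlin : LinearIndependent ℂ e := by
    refine Fintype.linearIndependent_iff.2 fun c hc => congrFun (hg c fun i => ?_)
    have := congrArg (φ i) hc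
    simpa using this
  have hinf : W₁ ⊓ W₂ = ⊥ := by
    refine (Submodule.eq_bot_iff _).2 fun v hv => ?_
    obtain ⟨c, rfl⟩ := (Submodule.mem_span_range_iff_exists_fun ℂ).1 hv.1
    have : c = 0 := hg c fun i => by simpa using (memW₂ _).1 hv.2 i
    simp [this]
  have hsup : W₁ ⊔ W₂ = ⊤ := by
    let G : (ι → ℂ) →ₗ[ℂ] (ι → ℂ) := LinearMap.pi φ ∘ₗ Fintype.linearCombination ℂ e
    have hG : ∀ c i, G c i = ∑ j, c j * φ i (e j) := fun c i => by
      simp [G, Fintype.linearCombination_apply]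
    have hinj : Function.Injective G := (injective_iff_map_eq_zero G).2 fun c hc =>
      hg c fun i => by rw [← hG, hc]; rfl
    refine eq_top_iff.2 fun v _ => ?_
    obtain ⟨c, hc⟩ := LinearMap.injective_iff_surjective.1 hinj (fun i => φ i v)
    refine Submodule.mem_sup.2 ⟨∑ j, c j • e j, ?_, v - ∑ j, c j • e j, ?_, by abel⟩
    · exact sum_mem fun i _ => Submodule.smul_mem _ _ (Submodule.subset_span ⟨i, rfl⟩)
    · refine (memW₂ _).2 fun i => ?_
      have := congrFun hc i
      rw [hG] at this
      simp [← this]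
  refine ⟨hlin, ?_⟩
  have hne : W₁ ≠ ⊥ := by
    intro h
    obtain ⟨i⟩ := ‹Nonempty ι›
    have : e i ∈ W₁ := Submodule.subset_span ⟨i, rfl⟩
    rw [h, Submodule.mem_bot] at this
    exact hlin.ne_zero i this
  have h2 := (hM.2 W₁ W₂ ⟨inv₁ _ (by simp), inv₁ _ (by simp), inv₁ _ (by simp)⟩
    ⟨inv₂ _ (by simp), inv₂ _ (by simp), inv₂ _ (by simp)⟩ hinf hsup).resolve_left hne
  rw [h2, sup_bot_eq] at hsup
  exact hsup.ge

/-- Structure constants of a module with a weight basis in which `P₊` and `P₋` have entries in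
`{-1, 0, 1}`. -/
abbrev Shape : Type :=
  Σ n : Fin 9, (Fin n → Fin n → SignType) × (Fin n → Fin n → SignType) × (Fin n → Fin 4)

/-- The module has a basis with the given structure constants, the weights being counted
from `a`. -/
def HasShape (a : ℤ) (t : Shape) : Prop :=
  ∃ β : Module.Basis (Fin t.1) ℂ M.V,
    (∀ i, M.Pp (β i) = ∑ j, (((t.2.1 i j : SignType) : ℤ) : ℂ) • β j) ∧
    (∀ i, M.Pm (β i) = ∑ j, (((t.2.2.1 i j : SignType) : ℤ) : ℂ) • β j) ∧
    (∀ i, M.L (β i) = ((a + (t.2.2.2 i : ℕ) : ℤ) : ℂ) • β i)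

variable {M} in
theorem HasShape.iso {N : E2Mod} {a : ℤ} {t : Shape} (hM : M.HasShape a t) (hN : N.HasShape a t) :
    M.Iso N := by
  obtain ⟨β, h1, h2, h3⟩ := hM
  obtain ⟨γ, g1, g2, g3⟩ := hN
  let e := β.equiv γ (Equiv.refl _)
  have he : ∀ i, e (β i) = γ i := fun i => β.equiv_apply i γ (Equiv.refl _)
  refine ⟨e, fun v => ?_, fun v => ?_, fun v => ?_⟩
  · have : e.toLinearMap ∘ₗ M.Pp = N.Pp ∘ₗ e.toLinearMap :=
      β.ext fun i => by simp [h1, g1, he]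
    exact LinearMap.congr_fun this v
  · have : e.toLinearMap ∘ₗ M.Pm = N.Pm ∘ₗ e.toLinearMap :=
      β.ext fun i => by simp [h2, g2, he]
    exact LinearMap.congr_fun this v
  · have : e.toLinearMap ∘ₗ M.L = N.L ∘ₗ e.toLinearMap :=
      β.ext fun i => by simp [h3, g3, he]
    exact LinearMap.congr_fun this v

variable {M} in
theorem exists_hasShape_of_basis {a : ℤ} {ι : Type} [Fintype ι] (hι : Fintype.card ι ≤ 8)
    (β : Module.Basis ι ℂ M.V) (hp : ∀ i, SmallComb β (M.Pp (β i)))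
    (hm : ∀ i, SmallComb β (M.Pm (β i))) (l : ι → Fin 4)
    (hl : ∀ i, M.L (β i) = ((a + (l i : ℕ) : ℤ) : ℂ) • β i) : ∃ t, M.HasShape a t := by
  choose p hp using hp
  choose m hm using hm
  let f := Fintype.equivFin ι
  refine ⟨⟨⟨Fintype.card ι, by omega⟩, fun i j => p (f.symm i) (f.symm j),
    fun i j => m (f.symm i) (f.symm j), fun i => l (f.symm i)⟩, β.reindex f, ?_, ?_, ?_⟩
  · intro i
    rw [Module.Basis.reindex_apply, hp]
    exact (Equiv.sum_comp f.symm _).symm.trans (by simp)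
  · intro i
    rw [Module.Basis.reindex_apply, hm]
    exact (Equiv.sum_comp f.symm _).symm.trans (by simp)
  · intro i
    rw [Module.Basis.reindex_apply, hl]

theorem frames_combine {w : Fin 4 → ℤ} (F : ∀ i, Frame (M.wt (w i)))
    (hw : ∀ k, (∀ i, w i ≠ k) → M.wt k = ⊥) (T : M.V →ₗ[ℂ] M.V) (d : ℤ)
    (R : ∀ {k l : ℤ}, l = k + d → (M.wt k →ₗ[ℂ] M.wt l))
    (hR : ∀ {k l : ℤ} (h : l = k + d) (v : M.wt k), (R h v : M.V) = T v)
    (hproj : ∀ {k l : ℤ} (h : l = k + d), M.proj l ∘ₗ T = R h ∘ₗ M.proj k)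
    (hF : ∀ i j, ∀ h : w j = w i + d, (F i).Maps (F j) (R h)) :
    (∀ x : Σ i, Fin (F i).n, SmallComb (fun y : Σ i, Fin (F i).n => ((F y.1).e y.2 : M.V))
      (T ((F x.1).e x.2))) ∧
    ∀ x : Σ i, Fin (F i).n, ((F x.1).φ x.2 ∘ₗ M.proj (w x.1)) ∘ₗ T ∈
      Submodule.span ℂ (Set.range fun y : Σ i, Fin (F i).n => (F y.1).φ y.2 ∘ₗ M.proj (w y.1)) := by
  refine ⟨fun ⟨i, s⟩ => ?_, fun ⟨j, t⟩ => ?_⟩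
  · by_cases h : ∃ j, w j = w i + d
    · obtain ⟨j, h⟩ := h
      rw [← hR h]
      exact SmallComb.of_comp (f := Sigma.mk j) sigma_mk_injective
        (((hF i j h).1 s).map (M.wt (w j)).subtype)
    · have h0 := (Submodule.eq_bot_iff _).1 (hw (w i + d) fun j hj => h ⟨j, hj⟩) _
        (R rfl ((F i).e s)).2
      rw [hR] at h0
      rw [h0]
      exact SmallComb.zero _
  · by_cases h : ∃ i, w j = w i + d
    · obtain ⟨i, h⟩ := h
      rw [LinearMap.comp_assoc, hproj h, ← LinearMap.comp_assoc]
      have h1 := Submodule.mem_map_of_mem (f := (M.proj (w i)).dualMap) ((hF i j h).2 t)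
      rw [Submodule.map_span] at h1
      refine Submodule.span_mono ?_ h1
      rintro _ ⟨_, ⟨s, rfl⟩, rfl⟩
      exact ⟨⟨i, s⟩, rfl⟩
    · have h0 : M.proj (w j - d) = 0 := by
        ext v
        exact (Submodule.eq_bot_iff _).1 (hw (w j - d) fun i hi => h ⟨i, by omega⟩) _
          (M.proj (w j - d) v).2
      rw [LinearMap.comp_assoc, hproj (show w j = w j - d + d by ring), h0]
      simp

variable {M} in
theorem Indecomposable.exists_hasShape_of_frames (hM : M.Indecomposable) {a : ℤ} {w : Fin 4 → ℤ}
    (hwa : ∀ i, w i = a + (i : ℕ)) (hw : ∀ k, (∀ i, w i ≠ k) → M.wt k = ⊥)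
    (F : ∀ i, Frame (M.wt (w i))) (hF : ∃ i, 0 < (F i).n)
    (hp : ∀ i j, ∀ h : w j = w i + 1, (F i).Maps (F j) (M.raise h))
    (hm : ∀ i j, ∀ h : w i = w j + 1, (F i).Maps (F j) (M.lower h)) : ∃ t, M.HasShape a t := by
  let e : (Σ i, Fin (F i).n) → M.V := fun y => (F y.1).e y.2
  let φ : (Σ i, Fin (F i).n) → Module.Dual ℂ M.V := fun y => (F y.1).φ y.2 ∘ₗ M.proj (w y.1)
  have hP := M.frames_combine F hw M.Pp 1 (fun h => M.raise h) (fun _ _ => rfl)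
    (fun h => M.proj_comp_Pp h) hp
  have hQ := M.frames_combine F hw M.Pm (-1) (fun {k l} h => M.lower (show k = l + 1 by omega))
    (fun _ _ => rfl) (fun h => M.proj_comp_Pm (by omega)) (fun i j h => hm i j (by omega))
  have hL : ∀ x, M.L (e x) = (w x.1 : ℂ) • e x := fun x => mem_wt.1 ((F x.1).e x.2).2
  have hinj : Function.Injective w := fun i j h => by
    have := hwa i
    have := hwa j
    omega
  have hg : ∀ c : (Σ i, Fin (F i).n) → ℂ, (∀ x, ∑ y, c y * φ x (e y) = 0) → c = 0 := fun c hc => by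
    funext ⟨i, s⟩
    refine congrFun ((F i).gram (fun s => c ⟨i, s⟩) fun t => ?_) s
    have h1 := hc ⟨i, t⟩
    rw [Fintype.sum_sigma, Finset.sum_eq_single i] at h1
    · simpa [φ, e, proj_coe] using h1
    · intro j _ hj
      refine Finset.sum_eq_zero fun s _ => ?_
      simp [φ, e, M.proj_of_ne (hinj.ne hj) _ ((F j).e s).2]
    · simp
  obtain ⟨i, hi⟩ := hF
  have : Nonempty (Σ i, Fin (F i).n) := ⟨⟨i, ⟨0, hi⟩⟩⟩
  obtain ⟨hli, hsp⟩ := hM.isBasis_of_gram hg fun T hT => by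
    rcases hT with rfl | rfl | rfl
    · exact ⟨fun x => (hP.1 x).mem_span, hP.2⟩
    · exact ⟨fun x => (hQ.1 x).mem_span, hQ.2⟩
    · refine ⟨fun x => ?_, fun x => ?_⟩
      · rw [hL]
        exact Submodule.smul_mem _ _ (Submodule.subset_span ⟨x, rfl⟩)
      · have : φ x ∘ₗ M.L = (w x.1 : ℂ) • φ x := by
          rw [LinearMap.comp_assoc, M.proj_comp_L, LinearMap.comp_smul]
        rw [this]
        exact Submodule.smul_mem _ _ (Submodule.subset_span ⟨x, rfl⟩)
  have hcoe : ⇑(Module.Basis.mk hli hsp) = e := Module.Basis.coe_mk hli hsp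
  refine exists_hasShape_of_basis ?_ (Module.Basis.mk hli hsp) ?_ ?_ Sigma.fst ?_
  · rw [Fintype.card_sigma]
    calc ∑ i, Fintype.card (Fin (F i).n) ≤ ∑ _i : Fin 4, 2 :=
          Finset.sum_le_sum fun i _ => by simpa using (F i).le
      _ = 8 := by simp
  · rw [hcoe]
    exact hP.1
  · rw [hcoe]
    exact hQ.1
  · rw [hcoe]
    exact fun x => by rw [hL, hwa]

variable {M} in
theorem Indecomposable.exists_hasShape (hM : M.Indecomposable) {a : ℤ}
    (h : ∀ k : ℤ, k < a ∨ a + 3 < k → M.wt k = ⊥) : ∃ t, M.HasShape a t := by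
  have hne : (∃ v : M.wt a, v ≠ 0) ∨ (∃ v : M.wt (a + 1), v ≠ 0) ∨
      (∃ v : M.wt (a + 2), v ≠ 0) ∨ ∃ v : M.wt (a + 3), v ≠ 0 := by
    obtain ⟨k, v, hv⟩ := M.exists_ne_zero_wt hM.1
    have hk : ¬(k < a ∨ a + 3 < k) := fun hk => hv <|
      Subtype.ext ((Submodule.eq_bot_iff _).1 (h k hk) v v.2)
    obtain rfl | rfl | rfl | rfl : k = a ∨ k = a + 1 ∨ k = a + 2 ∨ k = a + 3 := by omega
    · exact .inl ⟨v, hv⟩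
    · exact .inr (.inl ⟨v, hv⟩)
    · exact .inr (.inr (.inl ⟨v, hv⟩))
    · exact .inr (.inr (.inr ⟨v, hv⟩))
  obtain ⟨F₁, F₂, F₃, F₄, hpos, h₁, h₂, h₃, h₄, h₅, h₆⟩ := (rep h).hasSummand hne
  let w : Fin 4 → ℤ
    | 0 => a
    | 1 => a + 1
    | 2 => a + 2
    | 3 => a + 3
  have hwa : ∀ i, w i = a + (i : ℕ) := fun i => by fin_cases i <;> simp [w]
  let F : ∀ i, Frame (M.wt (w i))
    | 0 => F₁
    | 1 => F₂
    | 2 => F₃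
    | 3 => F₄
  refine hM.exists_hasShape_of_frames hwa (fun k hk => h k ?_) F ?_ ?_ ?_
  · have := hk 0
    have := hk 1
    have := hk 2
    have := hk 3
    simp only [w] at *
    omega
  · by_contra! hF
    have h0 : F₁.n ≤ 0 := hF 0
    have h1 : F₂.n ≤ 0 := hF 1
    have h2 : F₃.n ≤ 0 := hF 2
    have h3 : F₄.n ≤ 0 := hF 3
    omega
  · intro i j hij
    have hval : (j : ℕ) = i + 1 := by
      have := hwa i
      have := hwa j
      omega
    match i, j with
    | 0, 1 => exact h₁
    | 1, 2 => exact h₂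
    | 2, 3 => exact h₃
  · intro i j hij
    have hval : (i : ℕ) = j + 1 := by
      have := hwa i
      have := hwa j
      omega
    match i, j with
    | 1, 0 => exact h₄
    | 2, 1 => exact h₅
    | 3, 2 => exact h₆

end E2Mod

/-- For `a, b ∈ ℤ` with `0 ≤ b − a ≤ 3`, there are finitely many isomorphism classes of
indecomposable `e(2)`-modules whose weights lie between `a` and `b`. -/
theorem stmt_0 (a b : ℤ) (hab : 0 ≤ b - a) (hab' : b - a ≤ 3) :
    ∃ (n : ℕ) (Vs : Fin n → E2Mod),
      ∀ M : E2Mod, M.Indecomposable → (∀ k : ℤ, k < a ∨ b < k → M.wt k = ⊥) →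
        ∃ j : Fin n, M.Iso (Vs j) := by
  classical
  rcases isEmpty_or_nonempty E2Mod with hE | ⟨⟨N⟩⟩
  · exact ⟨0, fun j => j.elim0, fun M => hE.elim M⟩
  obtain ⟨n, ⟨f⟩⟩ := Finite.exists_equiv_fin E2Mod.Shape
  refine ⟨n, fun j => if h : ∃ M : E2Mod, M.HasShape a (f.symm j) then h.choose else N,
    fun M hM hwt => ?_⟩
  obtain ⟨t, ht⟩ := hM.exists_hasShape (a := a) fun k hk => hwt k (by omega)
  rw [← f.symm_apply_apply t] at ht
  have hex : ∃ M : E2Mod, M.HasShape a (f.symm (f t)) := ⟨M, ht⟩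
  refine ⟨f t, ?_⟩
  simp only [dif_pos hex]
  exact ht.iso hex.choose_spec
end

section
/- Let V be an e(2)-module. Then there exists N ∈ ℕ such that every composition of N endomorphisms, each of which is equal to P₊ or to P₋, is the zero endomorphism of V: for every f : Fin N → {P₊, P₋}, f(N−1) ∘ ⋯ ∘ f(1) ∘ f(0) = 0. -/
/-- In a finite-dimensional algebra over a field of characteristic zero, an eigenvector of
`x ↦ l * x - x * l` with nonzero eigenvalue is nilpotent. -/
theorem isNilpotent_of_mul_sub_mul_eq_smul {K A : Type*} [Field K] [CharZero K] [Ring A]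
    [Algebra K A] [FiniteDimensional K A] {l p : A} {c : K} (hc : c ≠ 0)
    (h : l * p - p * l = c • p) : IsNilpotent p := by
  have hpow (n : ℕ) : l * p ^ n - p ^ n * l = (n * c) • p ^ n := by
    induction n with
    | zero => simp
    | succ n ih =>
      calc l * p ^ (n + 1) - p ^ (n + 1) * l
          = (l * p ^ n - p ^ n * l) * p + p ^ n * (l * p - p * l) := by
            rw [pow_succ]; noncomm_ring
        _ = ((n + 1 : ℕ) * c) • p ^ (n + 1) := by
            rw [ih, h, smul_mul_assoc, mul_smul_comm, ← pow_succ, ← add_smul]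
            push_cast
            ring_nf
  by_contra hp
  have heig (n : ℕ) : Module.End.HasEigenvalue
      (LinearMap.mulLeft K l - LinearMap.mulRight K l) (n * c) :=
    Module.End.hasEigenvalue_of_hasEigenvector (x := p ^ n)
      ⟨Module.End.mem_eigenspace_iff.mpr (hpow n), fun h0 => hp ⟨n, h0⟩⟩
  refine Set.infinite_of_injective_forall_mem (f := fun n : ℕ => (n : K) * c) ?_ heig
    (Module.End.finite_hasEigenvalue _)
  exact fun m n hmn => Nat.cast_injective (mul_right_cancel₀ hc hmn)

/-- A product of factors each equal to one of two commuting elements is a product of powers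
of these elements. -/
theorem Commute.exists_list_prod_eq_pow_mul_pow {R : Type*} [Monoid R] {p q : R}
    (h : Commute p q) (l : List R) (hl : ∀ x ∈ l, x = p ∨ x = q) :
    ∃ a b : ℕ, a + b = l.length ∧ l.prod = p ^ a * q ^ b := by
  induction l with
  | nil => exact ⟨0, 0, by simp⟩
  | cons x l ih =>
    obtain ⟨a, b, hab, hprod⟩ := ih fun y hy => hl y (List.mem_cons_of_mem _ hy)
    rcases hl x List.mem_cons_self with rfl | rfl
    · exact ⟨a + 1, b, by simp; lia, by rw [List.prod_cons, hprod, pow_succ', mul_assoc]⟩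
    · refine ⟨a, b + 1, by simp; lia, ?_⟩
      rw [List.prod_cons, hprod, ← mul_assoc, ← (h.pow_left a).eq, mul_assoc, ← pow_succ']

/-- Every `e(2)`-module is "nilpotent": there is an `N` such that any composition of `N`
endomorphisms, each equal to `P₊` or `P₋`, is zero.  Here the composition
`f (N-1) ∘ ⋯ ∘ f 1 ∘ f 0` is the product of the list `[f (N-1), …, f 1, f 0]` in the
monoid of endomorphisms. -/
theorem stmt_7 (M : E2Mod) :
    ∃ N : ℕ, ∀ f : Fin N → Module.End ℂ M.V,
      (∀ i : Fin N, f i = M.Pp ∨ f i = M.Pm) →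
      ((List.ofFn f).reverse.prod : Module.End ℂ M.V) = 0 := by
  obtain ⟨m, hm⟩ : IsNilpotent (M.Pp : Module.End ℂ M.V) :=
    isNilpotent_of_mul_sub_mul_eq_smul (l := M.L) (one_ne_zero (α := ℂ))
      (M.relp.trans (one_smul ℂ M.Pp).symm)
  obtain ⟨n, hn⟩ : IsNilpotent (M.Pm : Module.End ℂ M.V) :=
    isNilpotent_of_mul_sub_mul_eq_smul (l := M.L) (neg_ne_zero.mpr (one_ne_zero (α := ℂ)))
      (M.relm.trans (neg_one_smul ℂ M.Pm).symm)
  refine ⟨m + n, fun f hf => ?_⟩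
  have hcomm : Commute (M.Pp : Module.End ℂ M.V) M.Pm := M.comm
  obtain ⟨a, b, hab, hprod⟩ := hcomm.exists_list_prod_eq_pow_mul_pow (List.ofFn f).reverse
    (by simpa [List.mem_ofFn] using hf)
  rw [List.length_reverse, List.length_ofFn] at hab
  rw [hprod]
  rcases le_or_gt m a with h | h
  · rw [pow_eq_zero_of_le h hm, zero_mul]
  · rw [pow_eq_zero_of_le (show n ≤ b by lia) hn, mul_zero]
end
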